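/- Let 0 < r < c and set q := (2c² − r² − 2c√(c² − r²))/r². Then q ∈ (0, 1) and γ(D̄(−c, r) ∪ D̄(c, r)) = √(c² − r²) · θ₂(q)². -/

import Mathlib

open Complex Filter Metric Set Topology Bornology MeasureTheory

noncomputable section

/-- `f` has value `l` at infinity and derivative `w` at infinity (within the set `s`), i.e.
`f(z) → l` and `z (f(z) - l) → w` as `z → ∞` within `s`. -/
def HasDerivAtInftyOn (f : ℂ → ℂ) (s : Set ℂ) (l w : ℂ) : Prop :=
  Tendsto f (cobounded ℂ ⊓ 𝓟 s) (𝓝 l) ∧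
    Tendsto (fun z => z * (f z - l)) (cobounded ℂ ⊓ 𝓟 s) (𝓝 w)

/-- The analytic capacity of a plane set `K`:
`γ(K) = sup { |f′(∞)| : f` holomorphic on `ℂ∞ ∖ K`, `‖f‖ ≤ 1 }`. -/
def analyticCapacity (K : Set ℂ) : ℝ :=
  sSup { r : ℝ | ∃ (f : ℂ → ℂ) (l w : ℂ),
    DifferentiableOn ℂ f Kᶜ ∧ (∀ z ∈ Kᶜ, ‖f z‖ ≤ 1) ∧
    HasDerivAtInftyOn f Kᶜ l w ∧ r = ‖w‖ }

/-- The Jacobi theta function `θ₂(q) = Σ_{n ∈ ℤ} q^{(n+1/2)²}` for real `q`. -/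
def jacobiTheta2R (q : ℝ) : ℝ := ∑' n : ℤ, q ^ (((n : ℝ) + 1 / 2) ^ 2)

/-! ### The infinite product `∏ (1 - Q^{2n} y)` -/

/-- The `q`-Pochhammer symbol `(y; Q²)_∞`. -/
def qp (Q : ℝ) (y : ℂ) : ℂ := ∏' n : ℕ, (1 + -((Q : ℂ) ^ (2 * n) * y))

lemma summable_pow_two_mul {Q : ℝ} (h0 : 0 < Q) (h1 : Q < 1) :
    Summable fun n : ℕ => Q ^ (2 * n) := by
  simp_rw [pow_mul]
  exact summable_geometric_of_lt_one (by positivity) (by nlinarith)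

lemma qp_summable {Q : ℝ} (h0 : 0 < Q) (h1 : Q < 1) (y : ℂ) :
    Summable fun n : ℕ => ‖-((Q : ℂ) ^ (2 * n) * y)‖ := by
  have : (fun n : ℕ => ‖-((Q : ℂ) ^ (2 * n) * y)‖) = fun n : ℕ => Q ^ (2 * n) * ‖y‖ := by
    ext n
    simp [abs_of_pos h0]
  rw [this]
  exact (summable_pow_two_mul h0 h1).mul_right _

lemma qp_multipliable {Q : ℝ} (h0 : 0 < Q) (h1 : Q < 1) (y : ℂ) :
    Multipliable fun n : ℕ => (1 + -((Q : ℂ) ^ (2 * n) * y)) :=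
  multipliable_one_add_of_summable (qp_summable h0 h1 y)

lemma qp_tendsto {Q : ℝ} (h0 : 0 < Q) (h1 : Q < 1) (y : ℂ) :
    Tendsto (fun N : ℕ => ∏ n ∈ Finset.range N, (1 + -((Q : ℂ) ^ (2 * n) * y))) atTop
      (𝓝 (qp Q y)) :=
  (qp_multipliable h0 h1 y).hasProd.tendsto_prod_nat

lemma qp_ne_zero {Q : ℝ} (h0 : 0 < Q) (h1 : Q < 1) {y : ℂ} (hy : ‖y‖ < 1) : qp Q y ≠ 0 := by
  refine tprod_one_add_ne_zero_of_summable (f := fun n : ℕ => -((Q : ℂ) ^ (2 * n) * y)) ?_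
    (qp_summable h0 h1 y)
  intro n h
  have h2 : (Q : ℂ) ^ (2 * n) * y = 1 := by linear_combination -h
  have h3 := congrArg norm h2
  have h4 : Q ^ (2 * n) ≤ 1 := pow_le_one₀ h0.le h1.le
  simp [abs_of_pos h0] at h3
  nlinarith [norm_nonneg y]

lemma qp_conj (Q : ℝ) (y : ℂ) : ‖qp Q (starRingEnd ℂ y)‖ = ‖qp Q y‖ := by
  have h : qp Q (starRingEnd ℂ y) = starRingEnd ℂ (qp Q y) := by
    unfold qp
    have := (Function.LeftInverse.map_tprod (L := SummationFilter.unconditional ℕ) (f := fun n : ℕ => (1 + -((Q : ℂ) ^ (2 * n) * y)))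
      (g := starRingEnd ℂ) (g' := starRingEnd ℂ) Complex.continuous_conj Complex.continuous_conj
      Complex.conj_conj)
    rw [this]
    simp
  rw [h, RCLike.norm_conj]

lemma qp_step {Q : ℝ} (h0 : 0 < Q) (h1 : Q < 1) (y : ℂ) :
    qp Q y = (1 - y) * qp Q ((Q : ℂ) ^ 2 * y) := by
  have he : (fun n : ℕ => (1 + -((Q : ℂ) ^ (2 * n) * ((Q : ℂ) ^ 2 * y)))) =
      fun n : ℕ => (1 + -((Q : ℂ) ^ (2 * (n + 1)) * y)) := by
    funext n
    rw [mul_add, pow_add, mul_assoc, mul_one]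
  have hm := qp_multipliable h0 h1 ((Q : ℂ) ^ 2 * y)
  rw [he] at hm
  have h3 := tprod_eq_zero_mul' (f := fun n : ℕ => (1 + -((Q : ℂ) ^ (2 * n) * y))) hm
  rw [qp, qp, he, h3]
  simp [sub_eq_add_neg]

lemma qp_differentiable {Q : ℝ} (h0 : 0 < Q) (h1 : Q < 1) : Differentiable ℂ (qp Q) := by
  intro y
  have hU : HasProdLocallyUniformlyOn (fun (n : ℕ) (y : ℂ) => (1 + -((Q : ℂ) ^ (2 * n) * y)))
      (fun y => ∏' n : ℕ, (1 + -((Q : ℂ) ^ (2 * n) * y))) (ball (0 : ℂ) (‖y‖ + 1)) := by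
    refine Summable.hasProdLocallyUniformlyOn_nat_one_add isOpen_ball
      (u := fun n : ℕ => Q ^ (2 * n) * (‖y‖ + 1))
      ((summable_pow_two_mul h0 h1).mul_right _) ?_ (fun n => by fun_prop)
    refine .of_forall fun n x hx => ?_
    have : ‖x‖ ≤ ‖y‖ + 1 := by simpa using (mem_ball_zero_iff.1 hx).le
    simp only [norm_neg, norm_mul, norm_pow, Complex.norm_real, Real.norm_eq_abs, abs_of_pos h0]
    gcongr
  have hd : DifferentiableOn ℂ (qp Q) (ball (0 : ℂ) (‖y‖ + 1)) :=
    hU.differentiableOn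
      (.of_forall fun _ ↦ by simpa [Finset.prod_fn] using
        DifferentiableOn.finsetProd (fun _ _ ↦ by fun_prop)) isOpen_ball
  exact hd.differentiableAt (isOpen_ball.mem_nhds (by simp))

/-! ### The identity of Gauss, through the finite identity of Shanks -/

/-- The partial products `∏ (1 - x^{2k}) / (1 - x^{2k-1})`. -/
def gP (x : ℝ) (n : ℕ) : ℝ := ∏ k ∈ Finset.range n, ((1 - x ^ (2 * k + 2)) / (1 - x ^ (2 * k + 1)))

lemma one_sub_pow_pos' {x : ℝ} (h0 : 0 < x) (h1 : x < 1) (n : ℕ) : 0 < 1 - x ^ (n + 1) := by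
  have := pow_lt_one₀ h0.le h1 (Nat.succ_ne_zero n)
  simpa using this

lemma gP_succ (x : ℝ) (n : ℕ) :
    gP x (n + 1) = gP x n * ((1 - x ^ (2 * n + 2)) / (1 - x ^ (2 * n + 1))) := by
  rw [gP, Finset.prod_range_succ, gP]

lemma gP_mono_step {x : ℝ} (h0 : 0 < x) (h1 : x < 1) (n : ℕ) :
    1 ≤ (1 - x ^ (2 * n + 2)) / (1 - x ^ (2 * n + 1)) := by
  rw [le_div_iff₀ (one_sub_pow_pos' h0 h1 _)]
  have : x ^ (2 * n + 2) ≤ x ^ (2 * n + 1) := pow_le_pow_of_le_one h0.le h1.le (by omega)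
  linarith

lemma gP_one_le {x : ℝ} (h0 : 0 < x) (h1 : x < 1) (n : ℕ) : 1 ≤ gP x n := by
  induction n with
  | zero => simp [gP]
  | succ n ih =>
    rw [gP_succ]
    nlinarith [gP_mono_step h0 h1 n]

/-- telescoping -/
lemma shanks_tele {x : ℝ} (h0 : 0 < x) (h1 : x < 1) (n m : ℕ) :
    ∑ s ∈ Finset.range (m + 1), (gP x (n + 1) / gP x s * x ^ (s * (2 * n + 3))
      - gP x n / gP x s * x ^ (s * (2 * n + 1))) =
    gP x n / gP x m * x ^ ((m + 1) * (2 * n + 1)) * (1 - x ^ (2 * m + 1)) / (1 - x ^ (2 * n + 1)) := by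
  have hn := (one_sub_pow_pos' h0 h1 (2 * n)).ne'
  have hP := fun k => (zero_lt_one.trans_le (gP_one_le h0 h1 k)).ne'
  induction m with
  | zero =>
    simp [gP_succ]
    simp [gP]
    field_simp
    ring
  | succ m ih =>
    rw [Finset.sum_range_succ, ih, gP_succ x n, gP_succ x m]
    have h3 := hP m
    have h4 := (one_sub_pow_pos' h0 h1 (2 * m)).ne'
    have h5 := (one_sub_pow_pos' h0 h1 (2 * m + 1)).ne'
    field_simp
    ring

lemma shanks {x : ℝ} (h0 : 0 < x) (h1 : x < 1) (n : ℕ) :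
    ∑ s ∈ Finset.range (2 * n), x ^ (s * (s + 1) / 2) =
      ∑ s ∈ Finset.range n, gP x n / gP x s * x ^ (s * (2 * n + 1)) := by
  have hP := fun k => (zero_lt_one.trans_le (gP_one_le h0 h1 k)).ne'
  induction n with
  | zero => simp
  | succ n ih =>
    have e1 : (2 * n) * (2 * n + 1) / 2 = n * (2 * n + 1) := by
      rw [mul_assoc]; simp
    have e2 : (2 * n + 1) * (2 * n + 1 + 1) / 2 = (n + 1) * (2 * n + 1) := by
      rw [show (2 * n + 1) * (2 * n + 1 + 1) = 2 * ((n + 1) * (2 * n + 1)) by ring]; simp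
    rw [show 2 * (n + 1) = 2 * n + 1 + 1 by ring, Finset.sum_range_succ, Finset.sum_range_succ, ih,
      Finset.sum_range_succ _ n, e1, e2]
    have hn := (one_sub_pow_pos' h0 h1 (2 * n)).ne'
    rcases n with _ | m
    · simp [gP]
      simp at hn
      field_simp
      ring
    · have ht := shanks_tele h0 h1 (m + 1) m
      rw [Finset.sum_sub_distrib] at ht
      have ht' := sub_eq_iff_eq_add.1 ht
      have : ∀ s, s * (2 * (m + 1) + 1 + 1 + 1) = s * (2 * (m + 1) + 3) := fun s => by ring
      simp only [this]
      rw [ht', gP_succ x (m + 1), gP_succ x m]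
      have h3 := hP m
      have h4 := (one_sub_pow_pos' h0 h1 (2 * m)).ne'
      have h5 := (one_sub_pow_pos' h0 h1 (2 * m + 1)).ne'
      field_simp
      ring

lemma gP_tendsto {x : ℝ} (h0 : 0 < x) (h1 : x < 1) :
    Tendsto (fun n => (gP x n : ℂ)) atTop (𝓝 (qp x (x ^ 2) / qp x x)) := by
  have hx : qp x x ≠ 0 := qp_ne_zero h0 h1 (by simpa [abs_of_pos h0] using h1)
  refine ((qp_tendsto h0 h1 (x ^ 2)).div (qp_tendsto h0 h1 x) hx).congr fun n => ?_
  simp only [Pi.div_apply]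
  rw [← Finset.prod_div_distrib, gP]
  push_cast
  refine Finset.prod_congr rfl fun k _ => ?_
  ring

lemma summable_tri {x : ℝ} (h0 : 0 < x) (h1 : x < 1) :
    Summable fun s : ℕ => x ^ (s * (s + 1) / 2) := by
  refine Summable.of_nonneg_of_le (fun s => by positivity) (fun s => ?_)
    (summable_geometric_of_lt_one h0.le h1)
  refine pow_le_pow_of_le_one h0.le h1.le ?_
  rw [Nat.le_div_iff_mul_le (by norm_num)]
  rcases s with _ | s
  · simp
  · nlinarith

lemma gauss {x : ℝ} (h0 : 0 < x) (h1 : x < 1) :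
    qp x (x ^ 2) / qp x x = ((∑' s : ℕ, x ^ (s * (s + 1) / 2) : ℝ) : ℂ) := by
  have hP := fun k => (zero_lt_one.trans_le (gP_one_le h0 h1 k))
  have hlim := gP_tendsto h0 h1
  have hre : Tendsto (gP x) atTop (𝓝 (qp x (x ^ 2) / qp x x).re) :=
    (Complex.continuous_re.tendsto _).comp hlim
  have h2n : Tendsto (fun n : ℕ => 2 * n) atTop atTop :=
    tendsto_id.const_mul_atTop' (by norm_num)
  have hs := (summable_tri h0 h1).hasSum.tendsto_sum_nat.comp h2n
  have hd : Tendsto (fun n => ∑ s ∈ Finset.range (2 * n), x ^ (s * (s + 1) / 2) - gP x n) atTop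
      (𝓝 0) := by
    obtain ⟨M, hM⟩ := hre.bddAbove_range
    have hM' : ∀ n, gP x n ≤ M := fun n => hM ⟨n, rfl⟩
    have hb : Tendsto (fun n : ℕ => M * (x ^ (2 * n) * (1 - x)⁻¹)) atTop (𝓝 0) := by
      have := ((summable_pow_two_mul h0 h1).tendsto_atTop_zero.mul_const ((1 - x)⁻¹)).const_mul M
      simpa using this
    refine squeeze_zero_norm' ?_ hb
    filter_upwards [eventually_gt_atTop 0] with n hn
    obtain ⟨m, rfl⟩ : ∃ m, n = m + 1 := ⟨n - 1, by omega⟩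
    rw [shanks h0 h1, Finset.sum_range_succ']
    have : gP x (m + 1) / gP x 0 * x ^ (0 * (2 * (m + 1) + 1)) = gP x (m + 1) := by simp [gP]
    rw [this, add_sub_cancel_right, Real.norm_of_nonneg]
    · have h5 : ∀ k ∈ Finset.range m, gP x (m + 1) / gP x (k + 1) *
          x ^ ((k + 1) * (2 * (m + 1) + 1)) ≤ M * x ^ (2 * (m + 1)) * x ^ k := by
        intro k _
        rw [mul_assoc, ← pow_add]
        have : gP x (m + 1) / gP x (k + 1) ≤ M :=
          (div_le_self (hP _).le (gP_one_le h0 h1 _)).trans (hM' _)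
        have h6 : x ^ ((k + 1) * (2 * (m + 1) + 1)) ≤ x ^ (2 * (m + 1) + k) :=
          pow_le_pow_of_le_one h0.le h1.le (by nlinarith)
        have : 0 ≤ M := (hP 0).le.trans (hM' 0)
        gcongr
      refine (Finset.sum_le_sum h5).trans ?_
      rw [← Finset.mul_sum, mul_assoc]
      have : 0 ≤ M := (hP 0).le.trans (hM' 0)
      gcongr
      rw [← tsum_geometric_of_lt_one h0.le h1]
      exact (summable_geometric_of_lt_one h0.le h1).sum_le_tsum _ (fun i _ => by positivity)
    · refine Finset.sum_nonneg fun k _ => ?_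
      have := hP (m + 1)
      have := hP (k + 1)
      positivity
  have hg : Tendsto (gP x) atTop (𝓝 (∑' s : ℕ, x ^ (s * (s + 1) / 2))) := by
    have := hs.sub hd
    simpa using this
  exact tendsto_nhds_unique hlim ((Complex.continuous_ofReal.tendsto _).comp hg)

lemma theta_eq {q : ℝ} (h0 : 0 < q) (h1 : q < 1) :
    jacobiTheta2R q = 2 * q ^ (1 / 4 : ℝ) * ∑' s : ℕ, (q ^ 2) ^ (s * (s + 1) / 2) := by
  have key : ∀ n : ℕ, q ^ (((n : ℝ) + 1 / 2) ^ 2) =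
      q ^ (1 / 4 : ℝ) * (q ^ 2) ^ (n * (n + 1) / 2) := by
    intro n
    have e : 2 * (n * (n + 1) / 2) = n * (n + 1) := Nat.mul_div_cancel' (Nat.even_mul_succ_self n).two_dvd
    rw [← pow_mul, e, ← Real.rpow_natCast q, ← Real.rpow_add h0]
    congr 1
    push_cast
    ring
  have hsum := ((summable_tri (x := q ^ 2) (by positivity) (by nlinarith)).hasSum.mul_left
    (q ^ (1 / 4 : ℝ)))
  have h1' : HasSum (fun n : ℕ => q ^ ((((n : ℤ) : ℝ) + 1 / 2) ^ 2))
      (q ^ (1 / 4 : ℝ) * ∑' s : ℕ, (q ^ 2) ^ (s * (s + 1) / 2)) := by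
    refine (congrArg (fun f => HasSum f _) (funext fun n => ?_)).mpr hsum
    rw [← key]; simp
  have h2' : HasSum (fun n : ℕ => q ^ ((((-((n : ℤ) + 1) : ℤ) : ℝ) + 1 / 2) ^ 2))
      (q ^ (1 / 4 : ℝ) * ∑' s : ℕ, (q ^ 2) ^ (s * (s + 1) / 2)) := by
    refine (congrArg (fun f => HasSum f _) (funext fun n => ?_)).mpr hsum
    rw [← key]
    congr 1
    push_cast
    ring
  have hz := HasSum.of_nat_of_neg_add_one (f := fun n : ℤ => q ^ (((n : ℝ) + 1 / 2) ^ 2)) h1' h2'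
  rw [jacobiTheta2R, hz.tsum_eq]
  ring

/-! ### The Ahlfors function of the annulus `ρ < |u| < 1/ρ` -/

/-- The zero-free factor of the Ahlfors function. -/
def hH (Q : ℝ) (u : ℂ) : ℂ :=
  qp Q ((Q : ℂ) ^ 2 * u ^ 2) * qp Q ((Q : ℂ) ^ 2 * (u ^ 2)⁻¹) /
    (qp Q ((Q : ℂ) * u ^ 2) * qp Q ((Q : ℂ) * (u ^ 2)⁻¹))

/-- The Ahlfors function. -/
def hF (ρ : ℝ) (u : ℂ) : ℂ := (ρ : ℂ) * (u - u⁻¹) * hH (ρ ^ 4) u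

/-- The open annulus. -/
def ann (ρ : ℝ) : Set ℂ := {u | ρ < ‖u‖ ∧ ‖u‖ < ρ⁻¹}

/-- The closed annulus. -/
def cann (ρ : ℝ) : Set ℂ := {u | ρ ≤ ‖u‖ ∧ ‖u‖ ≤ ρ⁻¹}

section annulus

variable {ρ : ℝ}

lemma isOpen_ann : IsOpen (ann ρ) :=
  (isOpen_lt continuous_const continuous_norm).inter (isOpen_lt continuous_norm continuous_const)

lemma isClosed_cann : IsClosed (cann ρ) :=
  (isClosed_le continuous_const continuous_norm).inter
    (isClosed_le continuous_norm continuous_const)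

lemma ann_subset_cann : ann ρ ⊆ cann ρ := fun _ h => ⟨h.1.le, h.2.le⟩

lemma isBounded_ann : IsBounded (ann ρ) :=
  (isBounded_ball (x := (0 : ℂ)) (r := ρ⁻¹)).subset fun u hu => by simpa using hu.2

lemma cann_bounds (h0 : 0 < ρ) (h1 : ρ < 1) {u : ℂ} (hu : u ∈ cann ρ) :
    u ≠ 0 ∧ ‖((ρ ^ 4 : ℝ) : ℂ) * u ^ 2‖ < 1 ∧ ‖((ρ ^ 4 : ℝ) : ℂ) * (u ^ 2)⁻¹‖ < 1 ∧
    ‖((ρ ^ 4 : ℝ) : ℂ) ^ 2 * u ^ 2‖ < 1 ∧ ‖((ρ ^ 4 : ℝ) : ℂ) ^ 2 * (u ^ 2)⁻¹‖ < 1 := by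
  have hu0 : 0 < ‖u‖ := h0.trans_le hu.1
  have hv : ‖u‖ ≤ ρ⁻¹ := hu.2
  have hA : ρ * ‖u‖ ≤ 1 := by
    calc ρ * ‖u‖ ≤ ρ * ρ⁻¹ := by gcongr
      _ = 1 := mul_inv_cancel₀ h0.ne'
  have hB : ρ * ‖u‖⁻¹ ≤ 1 := by
    rw [← div_eq_mul_inv, div_le_one hu0]; exact hu.1
  have p2 : ρ ^ 2 < 1 := pow_lt_one₀ h0.le h1 (by norm_num)
  have p6 : ρ ^ 6 < 1 := pow_lt_one₀ h0.le h1 (by norm_num)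
  have hA2 : (ρ * ‖u‖) ^ 2 ≤ 1 := pow_le_one₀ (by positivity) hA
  have hB2 : (ρ * ‖u‖⁻¹) ^ 2 ≤ 1 := pow_le_one₀ (by positivity) hB
  have hn : ‖((ρ ^ 4 : ℝ) : ℂ)‖ = ρ ^ 4 := by
    rw [Complex.norm_real, Real.norm_of_nonneg (by positivity)]
  refine ⟨norm_pos_iff.1 hu0, ?_, ?_, ?_, ?_⟩ <;>
    simp only [norm_mul, norm_pow, norm_inv, hn]
  · calc ρ ^ 4 * ‖u‖ ^ 2 = ρ ^ 2 * (ρ * ‖u‖) ^ 2 := by ring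
      _ ≤ ρ ^ 2 * 1 := by gcongr
      _ < 1 := by linarith
  · calc ρ ^ 4 * (‖u‖ ^ 2)⁻¹ = ρ ^ 2 * (ρ * ‖u‖⁻¹) ^ 2 := by ring
      _ ≤ ρ ^ 2 * 1 := by gcongr
      _ < 1 := by linarith
  · calc (ρ ^ 4) ^ 2 * ‖u‖ ^ 2 = ρ ^ 6 * (ρ * ‖u‖) ^ 2 := by ring
      _ ≤ ρ ^ 6 * 1 := by gcongr
      _ < 1 := by linarith
  · calc (ρ ^ 4) ^ 2 * (‖u‖ ^ 2)⁻¹ = ρ ^ 6 * (ρ * ‖u‖⁻¹) ^ 2 := by ring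
      _ ≤ ρ ^ 6 * 1 := by gcongr
      _ < 1 := by linarith

lemma rho4 (h0 : 0 < ρ) (h1 : ρ < 1) : 0 < ρ ^ 4 ∧ ρ ^ 4 < 1 :=
  ⟨by positivity, pow_lt_one₀ h0.le h1 (by norm_num)⟩

lemma hH_diff (h0 : 0 < ρ) (h1 : ρ < 1) {u : ℂ} (hu : u ∈ cann ρ) :
    DifferentiableAt ℂ (hH (ρ ^ 4)) u := by
  obtain ⟨hu0, a1, a2, -, -⟩ := cann_bounds h0 h1 hu
  have hQ := rho4 h0 h1
  have hd := qp_differentiable hQ.1 hQ.2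
  have d1 : DifferentiableAt ℂ (fun u : ℂ => u ^ 2) u := by fun_prop
  have d2 : DifferentiableAt ℂ (fun u : ℂ => (u ^ 2)⁻¹) u := d1.inv (pow_ne_zero 2 hu0)
  have e1 := (hd _).comp u (d1.const_mul (((ρ ^ 4 : ℝ) : ℂ) ^ 2))
  have e2 := (hd _).comp u (d2.const_mul (((ρ ^ 4 : ℝ) : ℂ) ^ 2))
  have e3 := (hd _).comp u (d1.const_mul ((ρ ^ 4 : ℝ) : ℂ))
  have e4 := (hd _).comp u (d2.const_mul ((ρ ^ 4 : ℝ) : ℂ))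
  exact (e1.mul e2).div (e3.mul e4)
    (mul_ne_zero (qp_ne_zero hQ.1 hQ.2 a1) (qp_ne_zero hQ.1 hQ.2 a2))

lemma hH_ne (h0 : 0 < ρ) (h1 : ρ < 1) {u : ℂ} (hu : u ∈ cann ρ) : hH (ρ ^ 4) u ≠ 0 := by
  obtain ⟨hu0, a1, a2, a3, a4⟩ := cann_bounds h0 h1 hu
  have hQ := rho4 h0 h1
  exact div_ne_zero
    (mul_ne_zero (qp_ne_zero hQ.1 hQ.2 a3) (qp_ne_zero hQ.1 hQ.2 a4))
    (mul_ne_zero (qp_ne_zero hQ.1 hQ.2 a1) (qp_ne_zero hQ.1 hQ.2 a2))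

lemma hF_diff (h0 : 0 < ρ) (h1 : ρ < 1) {u : ℂ} (hu : u ∈ cann ρ) :
    DifferentiableAt ℂ (hF ρ) u := by
  obtain ⟨hu0, -⟩ := cann_bounds h0 h1 hu
  exact (((differentiableAt_id.sub (differentiableAt_inv hu0)).const_mul (ρ : ℂ))).mul
    (hH_diff h0 h1 hu)

lemma hF_inv (u : ℂ) : hF ρ u⁻¹ = - hF ρ u := by
  have : hH (ρ ^ 4) u⁻¹ = hH (ρ ^ 4) u := by
    unfold hH
    simp only [inv_pow, inv_inv]
    rw [mul_comm (qp _ _), mul_comm (qp _ (_ * _⁻¹)) (qp _ (((ρ ^ 4 : ℝ) : ℂ) * u ^ 2))]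
  unfold hF
  rw [this, inv_inv]
  ring

lemma hF_norm_inner (h0 : 0 < ρ) (h1 : ρ < 1) {u : ℂ} (hu : ‖u‖ = ρ) : ‖hF ρ u‖ = 1 := by
  have hu' : u ∈ cann ρ := ⟨hu.ge, hu.le.trans (h1.le.trans ((one_le_inv₀ h0).2 h1.le))⟩
  obtain ⟨hu0, a1, a2, a3, a4⟩ := cann_bounds h0 h1 hu'
  have hQ := rho4 h0 h1
  have hF' : hF ρ u = -(ρ * u⁻¹) * (qp (ρ ^ 4) (u ^ 2) *
      qp (ρ ^ 4) (((ρ ^ 4 : ℝ) : ℂ) ^ 2 * (u ^ 2)⁻¹)) /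
    (qp (ρ ^ 4) (((ρ ^ 4 : ℝ) : ℂ) * u ^ 2) * qp (ρ ^ 4) (((ρ ^ 4 : ℝ) : ℂ) * (u ^ 2)⁻¹)) := by
    rw [qp_step hQ.1 hQ.2 (u ^ 2), hF, hH]
    have : u - u⁻¹ = -u⁻¹ * (1 - u ^ 2) := by field_simp; ring
    rw [this]
    ring
  have hcc : starRingEnd ℂ u * u = (ρ : ℂ) ^ 2 := by
    rw [mul_comm, Complex.mul_conj, Complex.normSq_eq_norm_sq, hu]; push_cast; rfl
  have hcu : starRingEnd ℂ u ≠ 0 := by simpa using hu0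
  have c1 : ‖qp (ρ ^ 4) (((ρ ^ 4 : ℝ) : ℂ) * (u ^ 2)⁻¹)‖ = ‖qp (ρ ^ 4) (u ^ 2)‖ := by
    rw [← qp_conj]
    congr 2
    simp only [map_mul, map_inv₀, map_pow, Complex.conj_ofReal]
    push_cast
    rw [← div_eq_mul_inv, div_eq_iff (pow_ne_zero 2 hcu)]
    linear_combination - (starRingEnd ℂ u * u + (ρ : ℂ) ^ 2) * hcc
  have c2 : ‖qp (ρ ^ 4) (((ρ ^ 4 : ℝ) : ℂ) ^ 2 * (u ^ 2)⁻¹)‖ =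
      ‖qp (ρ ^ 4) (((ρ ^ 4 : ℝ) : ℂ) * u ^ 2)‖ := by
    rw [← qp_conj]
    congr 2
    simp only [map_mul, map_inv₀, map_pow, Complex.conj_ofReal]
    push_cast
    rw [← div_eq_mul_inv, div_eq_iff (pow_ne_zero 2 hcu)]
    linear_combination - (ρ : ℂ) ^ 4 * (starRingEnd ℂ u * u + (ρ : ℂ) ^ 2) * hcc
  have n1 : ‖qp (ρ ^ 4) (u ^ 2)‖ ≠ 0 := by
    rw [← c1]; exact norm_ne_zero_iff.2 (qp_ne_zero hQ.1 hQ.2 a2)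
  have n2 := norm_ne_zero_iff.2 (qp_ne_zero hQ.1 hQ.2 a1)
  rw [hF', norm_div, norm_mul, norm_mul, norm_mul, norm_neg, norm_mul, c1, c2, norm_inv, hu,
    Complex.norm_real, Real.norm_of_nonneg h0.le, mul_inv_cancel₀ h0.ne', one_mul, mul_comm]
  exact div_self (mul_ne_zero n2 n1)

lemma hF_norm_outer (h0 : 0 < ρ) (h1 : ρ < 1) {u : ℂ} (hu : ‖u‖ = ρ⁻¹) : ‖hF ρ u‖ = 1 := by
  have := hF_norm_inner h0 h1 (u := u⁻¹) (by rw [norm_inv, hu, inv_inv])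
  rwa [hF_inv, norm_neg] at this

lemma one_mem_ann (h0 : 0 < ρ) (h1 : ρ < 1) : (1 : ℂ) ∈ ann ρ := by
  simpa [ann] using ⟨h1, (one_lt_inv₀ h0).2 h1⟩

lemma hF_hasDerivAt_one (h0 : 0 < ρ) (h1 : ρ < 1) :
    HasDerivAt (hF ρ) (2 * ρ * hH (ρ ^ 4) 1) 1 := by
  have hH' := (hH_diff h0 h1 (ann_subset_cann (one_mem_ann h0 h1))).hasDerivAt
  have := (((hasDerivAt_id (1 : ℂ)).sub (hasDerivAt_inv one_ne_zero)).const_mul (ρ : ℂ)).mul hH'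
  refine this.congr_deriv ?_
  simp
  left
  ring

lemma hF_le_one (h0 : 0 < ρ) (h1 : ρ < 1) {u : ℂ} (hu : u ∈ ann ρ) : ‖hF ρ u‖ ≤ 1 := by
  have hcl : closure (ann ρ) ⊆ cann ρ := closure_minimal ann_subset_cann isClosed_cann
  refine Complex.norm_le_of_forall_mem_frontier_norm_le (isBounded_ann (ρ := ρ))
    (DifferentiableOn.diffContOnCl fun z hz => (hF_diff h0 h1 (hcl hz)).differentiableWithinAt)
    (fun z hz => ?_) (subset_closure hu)
  rw [frontier, isOpen_ann.interior_eq] at hz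
  have hz1 := hcl hz.1
  rcases hz1.1.lt_or_eq with h | h
  · rcases hz1.2.lt_or_eq with h' | h'
    · exact absurd ⟨h, h'⟩ hz.2
    · exact (hF_norm_outer h0 h1 h').le
  · exact (hF_norm_inner h0 h1 h.symm).le

/-- The extremal property. -/
lemma ann_upper (h0 : 0 < ρ) (h1 : ρ < 1) {G : ℂ → ℂ} (hG : DifferentiableOn ℂ G (ann ρ))
    (hG1 : ∀ u ∈ ann ρ, ‖G u‖ ≤ 1) (hp : G 1 = 0) (hm : G (-1) = 0) {d : ℂ}
    (hd : HasDerivAt G d 1) : ‖d‖ ≤ 2 * ρ * ‖hH (ρ ^ 4) 1‖ := by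
  have o1 := one_mem_ann h0 h1
  have om : (-1 : ℂ) ∈ ann ρ := by simpa [ann] using o1
  have D1 : DifferentiableOn ℂ (dslope G 1) (ann ρ) :=
    (Complex.differentiableOn_dslope (isOpen_ann.mem_nhds o1)).2 hG
  have D2 : DifferentiableOn ℂ (dslope (dslope G 1) (-1)) (ann ρ) :=
    (Complex.differentiableOn_dslope (isOpen_ann.mem_nhds om)).2 D1
  set G2 := dslope (dslope G 1) (-1) with hG2
  have E1 : ∀ u, (u - 1) * dslope G 1 u = G u := fun u => by
    have := sub_smul_dslope G 1 u
    simpa [hp] using this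
  have hm1 : dslope G 1 (-1) = 0 := by
    have := E1 (-1)
    rw [hm] at this
    rcases mul_eq_zero.1 this with h | h
    · norm_num at h
    · exact h
  have E2 : ∀ u, (u + 1) * G2 u = dslope G 1 u := fun u => by
    have := sub_smul_dslope (dslope G 1) (-1) u
    simpa [hm1] using this
  have G21 : 2 * G2 1 = d := by
    have := E2 1
    rw [dslope_same, hd.deriv] at this
    rw [← this]; norm_num
  -- the quotient
  set k : ℂ → ℂ := fun u => G2 u * u / (ρ * hH (ρ ^ 4) u) with hk
  have hρ : (ρ : ℂ) ≠ 0 := by exact_mod_cast h0.ne'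
  have kd : DifferentiableOn ℂ k (ann ρ) := by
    refine (D2.mul differentiableOn_id).div ?_ ?_
    · exact fun u hu => ((hH_diff h0 h1 (ann_subset_cann hu)).const_mul _).differentiableWithinAt
    · exact fun u hu => mul_ne_zero hρ (hH_ne h0 h1 (ann_subset_cann hu))
  have kF : ∀ u ∈ ann ρ, k u * hF ρ u = G u := by
    intro u hu
    have hu0 := (cann_bounds h0 h1 (ann_subset_cann hu)).1
    have := hH_ne h0 h1 (ann_subset_cann hu)
    simp only [hk, hF]
    rw [← E1, ← E2]
    field_simp
    ring
  have hcl : closure (ann ρ) ⊆ cann ρ := closure_minimal ann_subset_cann isClosed_cann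
  have bound : ∀ t : ℝ, 0 < t → t < 1 → ‖k 1‖ ≤ t⁻¹ := by
    intro t ht0 ht1
    set U : Set ℂ := {u | u ∈ ann ρ ∧ ‖hF ρ u‖ < t} with hU
    have contF : ContinuousOn (fun u => ‖hF ρ u‖) (cann ρ) := fun u hu =>
      (hF_diff h0 h1 hu).continuousAt.norm.continuousWithinAt
    have hUo : IsOpen U := (contF.mono ann_subset_cann).isOpen_inter_preimage isOpen_ann isOpen_Iio
    have hUc : closure U ⊆ {u | u ∈ cann ρ ∧ ‖hF ρ u‖ ≤ t} := by
      refine closure_minimal (fun u hu => ⟨ann_subset_cann hu.1, hu.2.le⟩) ?_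
      exact contF.preimage_isClosed_of_isClosed isClosed_cann isClosed_Iic
    have hUa : closure U ⊆ ann ρ := by
      intro u hu
      obtain ⟨h2, h3⟩ := hUc hu
      refine ⟨lt_of_le_of_ne h2.1 fun h => ?_, lt_of_le_of_ne h2.2 fun h => ?_⟩
      · rw [hF_norm_inner h0 h1 h.symm] at h3; linarith
      · rw [hF_norm_outer h0 h1 h] at h3; linarith
    have h1U : (1 : ℂ) ∈ U := ⟨o1, by simpa [hF] using ht0⟩
    refine Complex.norm_le_of_forall_mem_frontier_norm_le
      ((isBounded_ann (ρ := ρ)).subset fun u hu => hu.1)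
      (DifferentiableOn.diffContOnCl (kd.mono hUa)) (fun z hz => ?_) (subset_closure h1U)
    rw [frontier, hUo.interior_eq] at hz
    have hza := hUa hz.1
    have hzt : ‖hF ρ z‖ = t := le_antisymm (hUc hz.1).2 (not_lt.1 fun h => hz.2 ⟨hza, h⟩)
    have := kF z hza
    have h4 : ‖k z‖ * t ≤ 1 := by
      rw [← hzt, ← norm_mul, this]; exact hG1 z hza
    rwa [inv_eq_one_div, le_div_iff₀ ht0]
  have hk1 : ‖k 1‖ ≤ 1 := by
    by_contra! h
    have hpos : 0 < ‖k 1‖ := by linarith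
    obtain ⟨t, ht, ht1⟩ := exists_between (inv_lt_one_of_one_lt₀ h)
    have ht0 : 0 < t := (inv_pos.2 hpos).trans ht
    have := bound t ht0 ht1
    have h5 : t⁻¹ < ‖k 1‖ := inv_lt_of_inv_lt₀ hpos ht
    linarith
  have hH1 := hH_ne h0 h1 (ann_subset_cann o1)
  have : d = 2 * ρ * hH (ρ ^ 4) 1 * k 1 := by
    rw [← G21]
    simp only [hk]
    field_simp
  rw [this, norm_mul, norm_mul, norm_mul, Complex.norm_real, Real.norm_of_nonneg h0.le]
  have : 0 ≤ 2 * ρ * ‖hH (ρ ^ 4) 1‖ := by positivity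
  simp only [Complex.norm_ofNat]
  nlinarith

end annulus

lemma hH_one {Q : ℝ} (h0 : 0 < Q) (h1 : Q < 1) :
    ‖hH Q 1‖ = (∑' s : ℕ, Q ^ (s * (s + 1) / 2)) ^ 2 := by
  have : hH Q 1 = (qp Q ((Q : ℂ) ^ 2) / qp Q Q) ^ 2 := by
    simp [hH]
    ring
  rw [this, gauss h0 h1, norm_pow, Complex.norm_real, Real.norm_eq_abs, sq_abs]

/-! ### Transfer to the complement of the two disks -/

lemma norm_sub_real_sq (z : ℂ) (x : ℝ) : ‖z - x‖ ^ 2 = (z.re - x) ^ 2 + z.im ^ 2 := by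
  rw [← Complex.normSq_eq_norm_sq, Complex.normSq_apply]
  simp
  ring

lemma norm_add_real_sq (z : ℂ) (x : ℝ) : ‖z + x‖ ^ 2 = (z.re + x) ^ 2 + z.im ^ 2 := by
  rw [← Complex.normSq_eq_norm_sq, Complex.normSq_apply]
  simp
  ring

section transfer

variable {a c r ρ : ℝ}

lemma circle_iff (ha : 0 < a) (hr : 0 < r) (hac : a < c) (ha2 : a ^ 2 = c ^ 2 - r ^ 2)
    (hρ : 0 < ρ) (hρ2 : ρ ^ 2 * (c + a) = c - a) (z : ℂ) :
    r < ‖z - c‖ ↔ ρ * ‖z + a‖ < ‖z - a‖ := by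
  rw [← pow_lt_pow_iff_left₀ hr.le (norm_nonneg _) two_ne_zero,
    ← pow_lt_pow_iff_left₀ (by positivity) (norm_nonneg _) two_ne_zero, mul_pow,
    norm_sub_real_sq, norm_sub_real_sq, norm_add_real_sq]
  have key : (c + a) * (((z.re - a) ^ 2 + z.im ^ 2) - ρ ^ 2 * ((z.re + a) ^ 2 + z.im ^ 2)) =
      2 * a * (((z.re - c) ^ 2 + z.im ^ 2) - r ^ 2) := by
    linear_combination (-((z.re + a) ^ 2 + z.im ^ 2)) * hρ2 + 2 * a * ha2
  have hca : 0 < c + a := by linarith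
  constructor
  · intro h
    have : 0 < (c + a) * (((z.re - a) ^ 2 + z.im ^ 2) - ρ ^ 2 * ((z.re + a) ^ 2 + z.im ^ 2)) := by
      rw [key]; exact mul_pos (by positivity) (by linarith)
    have := (pos_iff_pos_of_mul_pos this).1 hca
    linarith
  · intro h
    have : 0 < 2 * a * (((z.re - c) ^ 2 + z.im ^ 2) - r ^ 2) := by
      rw [← key]; exact mul_pos hca (by linarith)
    have := (pos_iff_pos_of_mul_pos this).1 (by positivity)
    linarith

lemma mem_compl_iff' (ha : 0 < a) (hr : 0 < r) (hac : a < c) (ha2 : a ^ 2 = c ^ 2 - r ^ 2)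
    (hρ : 0 < ρ) (hρ2 : ρ ^ 2 * (c + a) = c - a) (z : ℂ) :
    z ∈ (closedBall (-(c:ℂ)) r ∪ closedBall ((c:ℂ)) r)ᶜ ↔
      ρ * ‖z + a‖ < ‖z - a‖ ∧ ρ * ‖z - a‖ < ‖z + a‖ := by
  have h1 := circle_iff ha hr hac ha2 hρ hρ2 z
  have h2 := circle_iff ha hr hac ha2 hρ hρ2 (-z)
  have e1 : ‖-z - c‖ = ‖z + c‖ := by rw [← norm_neg]; congr 1; ring
  have e2 : ‖-z - a‖ = ‖z + a‖ := by rw [← norm_neg]; congr 1; ring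
  have e3 : ‖-z + a‖ = ‖z - a‖ := by rw [← norm_neg]; congr 1; ring
  rw [e1, e2, e3] at h2
  rw [← h1, ← h2]
  simp [dist_eq_norm, and_comm]

/-- `z ∈ Kᶜ` iff the Möbius image lies in the annulus. -/
lemma mem_compl_iff_ann (ha : 0 < a) (hr : 0 < r) (hac : a < c) (ha2 : a ^ 2 = c ^ 2 - r ^ 2)
    (hρ : 0 < ρ) (hρ2 : ρ ^ 2 * (c + a) = c - a) {z : ℂ}
    (hz : z ∈ (closedBall (-(c:ℂ)) r ∪ closedBall ((c:ℂ)) r)ᶜ) :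
    z + a ≠ 0 ∧ z - a ≠ 0 ∧ (z - a) / (z + a) ∈ ann ρ := by
  obtain ⟨h1, h2⟩ := (mem_compl_iff' ha hr hac ha2 hρ hρ2 z).1 hz
  have n1 : 0 < ‖z - a‖ := lt_of_le_of_lt (by positivity) h1
  have n2 : 0 < ‖z + a‖ := lt_of_le_of_lt (by positivity) h2
  refine ⟨norm_pos_iff.1 n2, norm_pos_iff.1 n1, ?_, ?_⟩
  · rw [norm_div, lt_div_iff₀ n2]; exact h1
  · rw [norm_div, div_lt_iff₀ n2, ← div_eq_inv_mul, lt_div_iff₀ hρ]; linarith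

/-- Inverse Möbius map. -/
lemma Z_mem (ha : 0 < a) (hr : 0 < r) (hac : a < c) (ha2 : a ^ 2 = c ^ 2 - r ^ 2)
    (hρ : 0 < ρ) (hρ2 : ρ ^ 2 * (c + a) = c - a) {u : ℂ} (hu : u ∈ ann ρ) (hu1 : u ≠ 1) :
    a * (1 + u) / (1 - u) ∈ (closedBall (-(c:ℂ)) r ∪ closedBall ((c:ℂ)) r)ᶜ := by
  have hu1' : 1 - u ≠ 0 := sub_ne_zero.2 hu1.symm
  have e1 : a * (1 + u) / (1 - u) + a = 2 * a / (1 - u) := by field_simp; ring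
  have e2 : a * (1 + u) / (1 - u) - a = 2 * a / (1 - u) * u := by field_simp; ring
  have ha' : (a : ℂ) ≠ 0 := by exact_mod_cast ha.ne'
  have hpos : 0 < ‖2 * a / (1 - u)‖ := norm_pos_iff.2 (div_ne_zero (by simpa using ha') hu1')
  rw [mem_compl_iff' ha hr hac ha2 hρ hρ2, e1, e2, norm_mul]
  have h1 : ρ * ‖u‖ < 1 := by
    calc ρ * ‖u‖ < ρ * ρ⁻¹ := by gcongr; exact hu.2
      _ = 1 := mul_inv_cancel₀ hρ.ne'
  constructor
  · rw [mul_comm]; exact mul_lt_mul_of_pos_left hu.1 hpos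
  · calc ρ * (‖2 * a / (1 - u)‖ * ‖u‖) = ‖2 * a / (1 - u)‖ * (ρ * ‖u‖) := by ring
      _ < ‖2 * a / (1 - u)‖ * 1 := by gcongr
      _ = _ := mul_one _

lemma neg_mem_K {z : ℂ} (hz : z ∈ (closedBall (-(c:ℂ)) r ∪ closedBall ((c:ℂ)) r)ᶜ) :
    -z ∈ (closedBall (-(c:ℂ)) r ∪ closedBall ((c:ℂ)) r)ᶜ := by
  have e1 : ‖-z - c‖ = ‖z + c‖ := by rw [← norm_neg]; congr 1; ring
  have e2 : ‖-z + c‖ = ‖z - c‖ := by rw [← norm_neg]; congr 1; ring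
  simp only [mem_compl_iff, mem_union, mem_closedBall, dist_eq_norm, sub_neg_eq_add, not_or,
    e1, e2] at hz ⊢
  exact ⟨hz.2, hz.1⟩

lemma cobounded_inf_eq : cobounded ℂ ⊓ 𝓟 (closedBall (-(c:ℂ)) r ∪ closedBall ((c:ℂ)) r)ᶜ =
    cobounded ℂ := by
  refine inf_eq_left.2 (le_principal_iff.2 ?_)
  exact isBounded_def.1 (isBounded_closedBall.union isBounded_closedBall)

lemma isOpen_Kc : IsOpen (closedBall (-(c:ℂ)) r ∪ closedBall ((c:ℂ)) r)ᶜ :=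
  (isClosed_closedBall.union isClosed_closedBall).isOpen_compl

/-- Möbius map sends infinity to `1`. -/
lemma tendsto_mobius : Tendsto (fun z : ℂ => (z - a) / (z + a)) (cobounded ℂ) (𝓝 1) := by
  have h1 : Tendsto (fun z : ℂ => z + a) (cobounded ℂ) (cobounded ℂ) :=
    tendsto_add_const_cobounded _
  have h2 : Tendsto (fun z : ℂ => 1 - 2 * a * (z + a)⁻¹) (cobounded ℂ) (𝓝 1) := by
    have := ((tendsto_inv₀_cobounded.comp h1).const_mul (2 * (a : ℂ))).const_sub 1
    simpa using this
  refine h2.congr' ?_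
  have : ∀ᶠ z : ℂ in cobounded ℂ, z + a ≠ 0 := h1.eventually (eventually_ne_cobounded 0)
  filter_upwards [this] with z hz
  field_simp
  ring

lemma upper (ha : 0 < a) (hr : 0 < r) (hac : a < c) (ha2 : a ^ 2 = c ^ 2 - r ^ 2)
    (hρ : 0 < ρ) (hρ1 : ρ < 1) (hρ2 : ρ ^ 2 * (c + a) = c - a) {f : ℂ → ℂ} {l w : ℂ}
    (hf : DifferentiableOn ℂ f (closedBall (-(c:ℂ)) r ∪ closedBall ((c:ℂ)) r)ᶜ)
    (hf1 : ∀ z ∈ (closedBall (-(c:ℂ)) r ∪ closedBall ((c:ℂ)) r)ᶜ, ‖f z‖ ≤ 1)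
    (hw : HasDerivAtInftyOn f (closedBall (-(c:ℂ)) r ∪ closedBall ((c:ℂ)) r)ᶜ l w) :
    ‖w‖ ≤ 4 * a * ρ * ‖hH (ρ ^ 4) 1‖ := by
  have ha' : (a : ℂ) ≠ 0 := by exact_mod_cast ha.ne'
  rw [HasDerivAtInftyOn, cobounded_inf_eq] at hw
  set Z : ℂ → ℂ := fun u => a * (1 + u) / (1 - u) with hZ
  set G : ℂ → ℂ := fun u => (f (Z u) - f (-(Z u))) / 2 with hG
  have Gp : G 1 = 0 := by simp [hG, hZ]
  have Gm : G (-1) = 0 := by simp [hG, hZ]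
  have ZK : ∀ u ∈ ann ρ, u ≠ 1 → Z u ∈ (closedBall (-(c:ℂ)) r ∪ closedBall ((c:ℂ)) r)ᶜ :=
    fun u hu hu1 => Z_mem ha hr hac ha2 hρ hρ2 hu hu1
  -- derivative at 1
  have hneg : Tendsto (fun z : ℂ => -z) (cobounded ℂ) (cobounded ℂ) := tendsto_neg_cobounded
  have t1 : Tendsto (fun z : ℂ => z * ((f z - f (-z)) / 2)) (cobounded ℂ) (𝓝 w) := by
    have := (hw.2.add (hw.2.comp hneg)).div_const 2
    rw [add_self_div_two] at this
    refine this.congr fun z => ?_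
    simp only [Function.comp]
    ring
  have t0 : Tendsto (fun z : ℂ => (f z - f (-z)) / 2) (cobounded ℂ) (𝓝 0) := by
    have := (hw.1.sub (hw.1.comp hneg)).div_const 2
    simpa using this
  have t2 : Tendsto (fun z : ℂ => -(z + a) * ((f z - f (-z)) / 2) / (2 * a)) (cobounded ℂ)
      (𝓝 (-w / (2 * a))) := by
    have := ((t1.add (t0.const_mul (a : ℂ))).neg).div_const (2 * (a : ℂ))
    simp only [mul_zero, add_zero] at this
    refine this.congr fun z => ?_
    ring
  have tZ : Tendsto Z (𝓝[≠] 1) (cobounded ℂ) := by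
    have h1 : Tendsto (fun u : ℂ => (1 - u)⁻¹) (𝓝[≠] 1) (cobounded ℂ) := by
      refine tendsto_inv₀_nhdsNE_zero.comp ?_
      refine tendsto_nhdsWithin_of_tendsto_nhds_of_eventually_within _ ?_ ?_
      · have : Tendsto (fun u : ℂ => 1 - u) (𝓝 1) (𝓝 (1 - 1)) := by
          exact (continuous_const.sub continuous_id).tendsto 1
        rw [sub_self] at this
        exact this.mono_left nhdsWithin_le_nhds
      · filter_upwards [self_mem_nhdsWithin] with u hu
        exact sub_ne_zero.2 (Ne.symm hu)
    have h2 : Tendsto (fun u : ℂ => (1 - u)⁻¹ * (2 * a) + -a) (𝓝[≠] 1) (cobounded ℂ) := by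
      refine (tendsto_add_const_cobounded _).comp ?_
      exact (tendsto_mul_right_cobounded (by simpa using ha')).comp h1
    refine h2.congr' ?_
    filter_upwards [self_mem_nhdsWithin] with u hu
    have : 1 - u ≠ 0 := sub_ne_zero.2 (Ne.symm hu)
    simp only [hZ]
    field_simp
    ring
  have hd : HasDerivAt G (-w / (2 * a)) 1 := by
    rw [hasDerivAt_iff_tendsto_slope]
    refine (t2.comp tZ).congr' ?_
    filter_upwards [self_mem_nhdsWithin] with u hu
    have h1 : 1 - u ≠ 0 := sub_ne_zero.2 (Ne.symm hu)
    have h2 : u - 1 ≠ 0 := sub_ne_zero.2 hu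
    have h3 : Z u + a = 2 * a / (1 - u) := by simp only [hZ]; field_simp; ring
    rw [slope_def_field, Gp, sub_zero]
    simp only [Function.comp]
    rw [h3]
    simp only [hG]
    rw [show u - 1 = -(1 - u) by ring]
    field_simp
  have hGd : DifferentiableOn ℂ G (ann ρ) := by
    intro u hu
    by_cases hu1 : u = 1
    · rw [hu1]; exact hd.differentiableAt.differentiableWithinAt
    · have h1 : 1 - u ≠ 0 := sub_ne_zero.2 (Ne.symm hu1)
      have dZ : DifferentiableAt ℂ Z u := by
        simp only [hZ]
        fun_prop (disch := exact h1)
      have k1 := ZK u hu hu1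
      have d1 := (hf.differentiableAt (isOpen_Kc.mem_nhds k1)).comp u dZ
      have d2 := DifferentiableAt.comp (f := fun u => -(Z u)) u (hf.differentiableAt (isOpen_Kc.mem_nhds (neg_mem_K k1)))
        dZ.neg
      exact ((d1.sub d2).div_const 2).differentiableWithinAt
  have hGb : ∀ u ∈ ann ρ, ‖G u‖ ≤ 1 := by
    intro u hu
    by_cases hu1 : u = 1
    · rw [hu1, Gp]; simp
    · have k1 := ZK u hu hu1
      have b1 := hf1 _ k1
      have b2 := hf1 _ (neg_mem_K k1)
      have b3 := norm_sub_le (f (Z u)) (f (-(Z u)))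
      simp only [hG, norm_div, Complex.norm_ofNat]
      linarith
  have := ann_upper hρ hρ1 hGd hGb Gp Gm hd
  rw [norm_div, norm_neg, norm_mul, Complex.norm_real, Real.norm_of_nonneg ha.le,
    Complex.norm_ofNat, div_le_iff₀ (by positivity)] at this
  linarith

lemma attained (ha : 0 < a) (hr : 0 < r) (hac : a < c) (ha2 : a ^ 2 = c ^ 2 - r ^ 2)
    (hρ : 0 < ρ) (hρ1 : ρ < 1) (hρ2 : ρ ^ 2 * (c + a) = c - a) :
    ∃ (f : ℂ → ℂ) (l w : ℂ),
      DifferentiableOn ℂ f (closedBall (-(c:ℂ)) r ∪ closedBall ((c:ℂ)) r)ᶜ ∧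
      (∀ z ∈ (closedBall (-(c:ℂ)) r ∪ closedBall ((c:ℂ)) r)ᶜ, ‖f z‖ ≤ 1) ∧
      HasDerivAtInftyOn f (closedBall (-(c:ℂ)) r ∪ closedBall ((c:ℂ)) r)ᶜ l w ∧
      4 * a * ρ * ‖hH (ρ ^ 4) 1‖ = ‖w‖ := by
  have ha' : (a : ℂ) ≠ 0 := by exact_mod_cast ha.ne'
  have F1 : hF ρ 1 = 0 := by simp [hF]
  have hd := hF_hasDerivAt_one hρ hρ1
  have hm := tendsto_mobius (a := a)
  refine ⟨fun z => hF ρ ((z - a) / (z + a)), 0, -(2 * a) * (2 * ρ * hH (ρ ^ 4) 1), ?_, ?_, ?_, ?_⟩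
  · intro z hz
    obtain ⟨n1, n2, h⟩ := mem_compl_iff_ann ha hr hac ha2 hρ hρ2 hz
    have dM : DifferentiableAt ℂ (fun z : ℂ => (z - a) / (z + a)) z := by
      fun_prop (disch := exact n1)
    exact (DifferentiableAt.comp z (hF_diff hρ hρ1 (ann_subset_cann h)) dM).differentiableWithinAt
  · intro z hz
    exact hF_le_one hρ hρ1 (mem_compl_iff_ann ha hr hac ha2 hρ hρ2 hz).2.2
  · rw [HasDerivAtInftyOn, cobounded_inf_eq]
    constructor
    · have := hd.continuousAt.tendsto.comp hm
      rwa [F1] at this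
    · have hne : ∀ᶠ z : ℂ in cobounded ℂ, z + a ≠ 0 :=
        (tendsto_add_const_cobounded (a : ℂ)).eventually (eventually_ne_cobounded 0)
      have hsub : ∀ z : ℂ, z + a ≠ 0 → (z - a) / (z + a) - 1 = -(2 * a) / (z + a) := by
        intro z hz
        field_simp
        ring
      have hm' : Tendsto (fun z : ℂ => (z - a) / (z + a)) (cobounded ℂ) (𝓝[≠] 1) := by
        refine tendsto_nhdsWithin_of_tendsto_nhds_of_eventually_within _ hm ?_
        filter_upwards [hne] with z hz
        refine sub_ne_zero.1 ?_
        rw [hsub z hz]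
        exact div_ne_zero (neg_ne_zero.2 (mul_ne_zero two_ne_zero ha')) hz
      have hs := (hasDerivAt_iff_tendsto_slope.1 hd).comp hm'
      have hz : Tendsto (fun z : ℂ => -(2 * (a : ℂ)) * (((z - a) / (z + a) + 1) / 2)) (cobounded ℂ)
          (𝓝 (-(2 * a))) := by
        have := ((hm.add_const 1).div_const 2).const_mul (-(2 * (a : ℂ)))
        rw [add_self_div_two, mul_one] at this
        exact this
      refine (hz.mul hs).congr' ?_
      filter_upwards [hne] with z hz
      simp only [Function.comp, slope_def_field, F1, sub_zero, hsub z hz]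
      field_simp
      ring
  · simp only [norm_mul, norm_neg, Complex.norm_real, Real.norm_of_nonneg ha.le,
      Real.norm_of_nonneg hρ.le, Complex.norm_ofNat]
    ring

end transfer

/-- For `0 < r < c` and `q = (2c² − r² − 2c√(c² − r²))/r²` one has
`q ∈ (0,1)` and `γ(D̄(−c,r) ∪ D̄(c,r)) = √(c² − r²) · θ₂(q)²`. -/
theorem analyticCapacity_two_disks (c r : ℝ) (hr : 0 < r) (hrc : r < c) :
    (2 * c ^ 2 - r ^ 2 - 2 * c * Real.sqrt (c ^ 2 - r ^ 2)) / r ^ 2 ∈ Set.Ioo (0:ℝ) 1 ∧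
    analyticCapacity (closedBall (-(c:ℂ)) r ∪ closedBall ((c:ℂ)) r) =
      Real.sqrt (c ^ 2 - r ^ 2) *
        jacobiTheta2R ((2 * c ^ 2 - r ^ 2 - 2 * c * Real.sqrt (c ^ 2 - r ^ 2)) / r ^ 2) ^ 2 := by
  have hpos : 0 < c ^ 2 - r ^ 2 := by nlinarith
  set a := Real.sqrt (c ^ 2 - r ^ 2) with ha_def
  have ha : 0 < a := Real.sqrt_pos.2 hpos
  have ha2 : a ^ 2 = c ^ 2 - r ^ 2 := Real.sq_sqrt hpos.le
  have hac : a < c := by nlinarith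
  have har : c - a < r := by nlinarith
  obtain ⟨ρ, hρd⟩ : ∃ ρ : ℝ, ρ = (c - a) / r := ⟨_, rfl⟩
  have hρ : 0 < ρ := by rw [hρd]; exact div_pos (by linarith) hr
  have hρ1 : ρ < 1 := by rw [hρd, div_lt_one hr]; exact har
  have hρr : ρ * r = c - a := by rw [hρd]; field_simp
  have hρ2 : ρ ^ 2 * (c + a) = c - a := by
    have : r ^ 2 * (ρ ^ 2 * (c + a)) = r ^ 2 * (c - a) := by
      linear_combination (ρ * r + (c - a)) * (c + a) * hρr - (c - a) * ha2
    exact mul_left_cancel₀ (by positivity) this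
  have hq : (2 * c ^ 2 - r ^ 2 - 2 * c * a) / r ^ 2 = ρ ^ 2 := by
    rw [div_eq_iff (by positivity)]
    linear_combination -(ρ * r + (c - a)) * hρr - ha2
  rw [hq]
  have q0 : 0 < ρ ^ 2 := by positivity
  have q1 : ρ ^ 2 < 1 := pow_lt_one₀ hρ.le hρ1 two_ne_zero
  refine ⟨⟨q0, q1⟩, ?_⟩
  have hval : a * jacobiTheta2R (ρ ^ 2) ^ 2 = 4 * a * ρ * ‖hH (ρ ^ 4) 1‖ := by
    rw [theta_eq q0 q1, hH_one (rho4 hρ hρ1).1 (rho4 hρ hρ1).2, ← pow_mul, mul_pow, mul_pow]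
    have : ((ρ ^ 2) ^ (1 / 4 : ℝ)) ^ 2 = ρ := by
      rw [← Real.rpow_natCast, ← Real.rpow_mul q0.le, ← Real.rpow_natCast, ← Real.rpow_mul hρ.le]
      norm_num
    rw [this]
    ring
  rw [hval, analyticCapacity]
  refine IsGreatest.csSup_eq ⟨attained ha hr hac ha2 hρ hρ1 hρ2, ?_⟩
  rintro x ⟨f, l, w, hf, hf1, hw, rfl⟩
  exact upper ha hr hac ha2 hρ hρ1 hρ2 hf hf1 hw
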